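/- (Deterministic core of Theorem B.3, discounted case.) Under hypotheses (i)–(iv) of the discounted inexact anchored iteration, the Bellman residual of the final iterate satisfies ‖𝒯_γ(Q^n) − Q^n‖_∞ ≤ 8·‖Q^0 − Q^*‖_∞/(n+2) + 2·ε. -/

import Mathlib

open Finset

/-- Sup norm `‖x‖_∞ = max_j |x j|` on a nonempty finite index set. -/
noncomputable def supNorm {J : Type*} [Fintype J] [Nonempty J] (x : J → ℝ) : ℝ :=
  univ.sup' univ_nonempty (fun j => |x j|)

/-- `P` is a transition kernel: nonnegative entries, each row sums to one. -/
def IsKernel {S A : Type*} [Fintype S] (P : S → A → S → ℝ) : Prop :=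
  (∀ s a s', 0 ≤ P s a s') ∧ (∀ s a, ∑ s', P s a s' = 1)

/-- The discounted Bellman operator
`𝒯_γ(Q)(s,a) = r(s,a) + γ·∑_{s'} P(s'|s,a)·max_{a'} Q(s',a')`. -/
noncomputable def bellmanD {S A : Type*} [Fintype S] [Fintype A] [Nonempty A]
    (γ : ℝ) (P : S → A → S → ℝ) (r : S → A → ℝ) (Q : S × A → ℝ) : S × A → ℝ :=
  fun p => r p.1 p.2 +
    γ * ∑ s', P p.1 p.2 s' * (univ.sup' univ_nonempty (fun a' => Q (s', a')))

/-- The anchoring coefficients `β_k = k/(k+2)`. -/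
noncomputable def beta (k : ℕ) : ℝ := (k : ℝ) / ((k : ℝ) + 2)

theorem supNorm_le_iff {J : Type*} [Fintype J] [Nonempty J] {x : J → ℝ} {c : ℝ} :
    supNorm x ≤ c ↔ ∀ j, |x j| ≤ c := by
  simp [supNorm]

theorem abs_le_supNorm {J : Type*} [Fintype J] [Nonempty J] (x : J → ℝ) (j : J) :
    |x j| ≤ supNorm x :=
  supNorm_le_iff.1 le_rfl j

theorem abs_sup'_sub_sup'_le {A : Type*} [Fintype A] [Nonempty A] {f g : A → ℝ} {c : ℝ}
    (h : ∀ a, |f a - g a| ≤ c) :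
    |univ.sup' univ_nonempty f - univ.sup' univ_nonempty g| ≤ c := by
  have key : ∀ u v : A → ℝ, (∀ a, u a - v a ≤ c) →
      univ.sup' univ_nonempty u ≤ c + univ.sup' univ_nonempty v := fun u v huv =>
    Finset.sup'_le _ _ fun a _ => by
      have := Finset.le_sup' v (mem_univ a)
      linarith [huv a]
  have h1 := key f g fun a => (abs_le.1 (h a)).2
  have h2 := key g f fun a => by linarith [(abs_le.1 (h a)).1]
  exact abs_le.2 ⟨by linarith, by linarith⟩

/-- For `0 ≤ γ ≤ 1` the Bellman operator is nonexpansive in the sup norm. -/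
theorem abs_bellmanD_sub_le {S A : Type*} [Fintype S] [Fintype A] [Nonempty A]
    {γ : ℝ} (hγ0 : 0 ≤ γ) (hγ1 : γ ≤ 1) {P : S → A → S → ℝ} (hP : IsKernel P)
    (r : S → A → ℝ) {Q Q' : S × A → ℝ} {c : ℝ}
    (h : ∀ p, |Q p - Q' p| ≤ c) (p : S × A) :
    |bellmanD γ P r Q p - bellmanD γ P r Q' p| ≤ c := by
  have hsum : |∑ s', P p.1 p.2 s' * (univ.sup' univ_nonempty (fun a' => Q (s', a')) -
      univ.sup' univ_nonempty (fun a' => Q' (s', a')))| ≤ c := by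
    calc _ ≤ ∑ s', P p.1 p.2 s' * c := by
          refine (Finset.abs_sum_le_sum_abs _ _).trans (Finset.sum_le_sum fun s' _ => ?_)
          rw [abs_mul, abs_of_nonneg (hP.1 _ _ _)]
          exact mul_le_mul_of_nonneg_left
            (abs_sup'_sub_sup'_le fun a => h (s', a)) (hP.1 _ _ _)
      _ = c := by rw [← Finset.sum_mul, hP.2, one_mul]
  have heq : bellmanD γ P r Q p - bellmanD γ P r Q' p =
      γ * ∑ s', P p.1 p.2 s' * (univ.sup' univ_nonempty (fun a' => Q (s', a')) -
        univ.sup' univ_nonempty (fun a' => Q' (s', a'))) := by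
    simp only [bellmanD, mul_sub, Finset.sum_sub_distrib]
    ring
  rw [heq, abs_mul, abs_of_nonneg hγ0]
  exact (mul_le_of_le_one_left (abs_nonneg _) hγ1).trans hsum

theorem abs_mul_add_mul_le {a b x y u v : ℝ} (ha : 0 ≤ a) (hb : 0 ≤ b)
    (hx : |x| ≤ u) (hy : |y| ≤ v) : |a * x + b * y| ≤ a * u + b * v := by
  refine (abs_add_le _ _).trans ?_
  rw [abs_mul, abs_mul, abs_of_nonneg ha, abs_of_nonneg hb]
  gcongr

theorem beta_nonneg (k : ℕ) : 0 ≤ beta k := by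
  unfold beta; positivity

theorem one_sub_beta (k : ℕ) : 1 - beta k = 2 / ((k : ℝ) + 2) := by
  unfold beta; field_simp; ring

theorem beta_succ_sub_beta (k : ℕ) :
    beta (k + 1) - beta k = 2 / (((k : ℝ) + 2) * (k + 3)) := by
  unfold beta; push_cast; field_simp; ring

/-- Deterministic core of Theorem B.3 (discounted case): under hypotheses (i)–(iv),
`‖𝒯_γ(Q^n) − Q^n‖_∞ ≤ 8·‖Q^0 − Q^*‖_∞/(n+2) + 2·ε`. -/
theorem savid_residual_bound

    {S A : Type*} [Fintype S] [Nonempty S] [Fintype A] [Nonempty A]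
    (γ : ℝ) (hγ0 : 0 < γ) (hγ1 : γ < 1)
    (P : S → A → S → ℝ) (hP : IsKernel P) (r : S → A → ℝ)
    (ε : ℝ) (hε : 0 ≤ ε) (n : ℕ)
    (Q T : ℕ → S × A → ℝ) (Qstar : S × A → ℝ)
    (h1 : ∀ k, 1 ≤ k → k ≤ n →
      Q k = fun p => (1 - beta k) * Q 0 p + beta k * T (k - 1) p)
    (h2 : ∀ k, k ≤ n → supNorm (fun p => T k p - bellmanD γ P r (Q k) p) ≤ ε)
    (h3 : Qstar = bellmanD γ P r Qstar)
    (h4 : ∀ k, 1 ≤ k → k ≤ n →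
      supNorm (fun p => T k p - T (k - 1) p) ≤ γ * supNorm (fun p => Q k p - Q (k - 1) p))
    :
    supNorm (fun p => bellmanD γ P r (Q n) p - Q n p)
      ≤ 8 * supNorm (fun p => Q 0 p - Qstar p) / ((n : ℝ) + 2) + 2 * ε := by
  set D := supNorm (fun p => Q 0 p - Qstar p) with hD
  have hQ0 : ∀ p, |Q 0 p - Qstar p| ≤ D := abs_le_supNorm (fun p => Q 0 p - Qstar p)
  have hD0 : 0 ≤ D := (abs_nonneg _).trans (hQ0 (Classical.arbitrary _))
  have hQ : ∀ k, k + 1 ≤ n → ∀ p,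
      Q (k + 1) p = (1 - beta (k + 1)) * Q 0 p + beta (k + 1) * T k p := fun k hk p => by
    rw [h1 (k + 1) (by omega) hk]; rfl
  have hT : ∀ k, k ≤ n → ∀ p, |T k p - bellmanD γ P r (Q k) p| ≤ ε := fun k hk =>
    supNorm_le_iff.1 (h2 k hk)
  have hTT : ∀ k, k + 1 ≤ n → ∀ c, (∀ p, |Q (k + 1) p - Q k p| ≤ c) →
      ∀ p, |T (k + 1) p - T k p| ≤ c := fun k hk c hc => by
    have hc' : supNorm (fun p => Q (k + 1) p - Q k p) ≤ c := supNorm_le_iff.2 hc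
    have h0 : 0 ≤ supNorm (fun p => Q (k + 1) p - Q k p) :=
      (abs_nonneg _).trans
        (abs_le_supNorm (fun p => Q (k + 1) p - Q k p) (Classical.arbitrary _))
    exact supNorm_le_iff.1 ((h4 (k + 1) (by omega) hk).trans
      ((mul_le_of_le_one_left h0 hγ1.le).trans hc'))
  have hTstar : ∀ k, k ≤ n → ∀ c, (∀ p, |Q k p - Qstar p| ≤ c) →
      ∀ p, |T k p - Qstar p| ≤ ε + c := fun k hk c hc p => by
    have hb := abs_bellmanD_sub_le hγ0.le hγ1.le hP r hc p
    rw [← h3] at hb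
    exact (abs_sub_le _ _ _).trans (add_le_add (hT k hk p) hb)
  have hQstar : ∀ k, k ≤ n → ∀ p, |Q k p - Qstar p| ≤ D + k / 3 * ε := by
    intro k
    induction k with
    | zero => intro _ p; simpa using hQ0 p
    | succ k ih =>
      intro hk p
      have hTk := hTstar k (by omega) _ (ih (by omega)) p
      have hb : 0 ≤ 1 - beta (k + 1) := by rw [one_sub_beta]; positivity
      have heq : Q (k + 1) p - Qstar p = (1 - beta (k + 1)) * (Q 0 p - Qstar p) +
          beta (k + 1) * (T k p - Qstar p) := by rw [hQ k hk]; ring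
      rw [heq]
      refine (abs_mul_add_mul_le hb (beta_nonneg _) (hQ0 p) hTk).trans (le_of_eq ?_)
      unfold beta
      push_cast
      field_simp
      ring
  have hTQ0 : ∀ k, k ≤ n → ∀ p, |T k p - Q 0 p| ≤ 2 * D + (k + 3) / 3 * ε := fun k hk p => by
    have hTk := hTstar k hk _ (hQstar k hk) p
    have := abs_sub_le (T k p) (Qstar p) (Q 0 p)
    rw [abs_sub_comm (Qstar p)] at this
    linarith [hQ0 p]
  have hdiff : ∀ k, k + 1 ≤ n → ∀ p, |Q (k + 1) p - Q k p| ≤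
      4 * (k + 1) / ((k + 2) * (k + 3)) * D + ε / 3 := by
    intro k
    induction k with
    | zero =>
      intro hk p
      have heq : Q (0 + 1) p - Q 0 p = 1 / 3 * (T 0 p - Q 0 p) := by
        rw [hQ 0 hk]; norm_num [beta]; ring
      have h0 := hTQ0 0 (by omega) p
      rw [heq, abs_mul]
      norm_num at h0 ⊢
      linarith
    | succ k ih =>
      intro hk p
      have hTk := hTT k (by omega) _ (ih (by omega)) p
      have h0 := hTQ0 k (by omega) p
      have hb : 0 ≤ beta (k + 1 + 1) - beta (k + 1) := by rw [beta_succ_sub_beta]; positivity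
      have heq : Q (k + 1 + 1) p - Q (k + 1) p = beta (k + 1 + 1) * (T (k + 1) p - T k p) +
          (beta (k + 1 + 1) - beta (k + 1)) * (T k p - Q 0 p) := by
        rw [hQ (k + 1) hk, hQ k (by omega)]; ring
      rw [heq]
      refine (abs_mul_add_mul_le (beta_nonneg _) hb hTk h0).trans (le_of_eq ?_)
      rw [beta_succ_sub_beta]
      unfold beta
      push_cast
      field_simp
      ring
  refine supNorm_le_iff.2 fun p => ?_
  have hTn := hT n le_rfl p
  rw [abs_sub_comm] at hTn
  refine (abs_sub_le _ (T n p) _).trans ?_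
  cases n with
  | zero =>
    have h0 := hTQ0 0 le_rfl p
    norm_num at h0 ⊢
    linarith
  | succ m =>
    have hTm := hTT m le_rfl _ (hdiff m le_rfl) p
    have h0 := hTQ0 m (by omega) p
    have hb : 0 ≤ 1 - beta (m + 1) := by rw [one_sub_beta]; positivity
    have heq : T (m + 1) p - Q (m + 1) p = 1 * (T (m + 1) p - T m p) +
        (1 - beta (m + 1)) * (T m p - Q 0 p) := by rw [hQ m le_rfl]; ring
    have hbound := abs_mul_add_mul_le zero_le_one hb hTm h0
    rw [← heq, one_sub_beta] at hbound
    have hcoef : 4 * ((m : ℝ) + 1) / ((m + 2) * (m + 3)) * D ≤ 4 / (m + 3) * D := by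
      gcongr ?_ * D
      rw [div_le_div_iff₀ (by positivity) (by positivity)]
      nlinarith [(Nat.cast_nonneg m : (0 : ℝ) ≤ m)]
    have hsum : 4 / ((m : ℝ) + 3) * D + ε / 3 +
        2 / (((m + 1 : ℕ) : ℝ) + 2) * (2 * D + (m + 3) / 3 * ε) + ε =
        8 * D / (((m + 1 : ℕ) : ℝ) + 2) + 2 * ε := by
      push_cast
      field_simp
      ring
    linarith
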